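/- Let ψ = Σ_{h∈G^{N−1}} α_h |c(h), h c(h)⟩ be an alignable vector (c : G^{N−1} → G, α_h ∈ ℂ). Then Π_inv(|ψ⟩⟨ψ|) = Σ_{h,j∈G^{N−1}} (α_h · conj(α_j) / |G|) |h;𝟙⟩⟨j;𝟙| + Σ_{h∈G^{N−1}} (|α_h|² / |G|) Π_{h;χ≠𝟙}. Consequently, for two alignable unit vectors ψ, ψ' the following are equivalent: (i) tr(A|ψ⟩⟨ψ|) = tr(A|ψ'⟩⟨ψ'|) for all A ∈ A_inv; (ii) ψ ≃ ψ'; (iii) ⟨ψ|A|ψ⟩ = ⟨ψ'|A|ψ'⟩ for all A ∈ A_phys. -/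

import Mathlib

noncomputable section

open Matrix

namespace QRF

section Defs

variable (G : Type) [Fintype G] [DecidableEq G] [CommGroup G]

/-- The `K`-particle Hilbert space `ℂ^{G^K}` (as functions `G^K → ℂ`). -/
abbrev Vec (K : ℕ) : Type := (Fin K → G) → ℂ

/-- Linear operators on the `K`-particle Hilbert space. -/
abbrev Op (K : ℕ) : Type := Matrix (Fin K → G) (Fin K → G) ℂ

variable {G}

/-- The standard basis vector `|x⟩`. -/
def ket {K : ℕ} (x : Fin K → G) : Vec G K := fun y => if y = x then 1 else 0

/-- The global translation `T_g`, `T_g |x₁,…,x_K⟩ = |g x₁, …, g x_K⟩`. -/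
def trans {K : ℕ} (g : G) : Op G K :=
  Matrix.of fun x y => if x = (fun i => g * y i) then 1 else 0

/-- The configuration `(g, h₁ g, …, h_k g)`, i.e. `|g, hg⟩`. -/
def cfg {k : ℕ} (h : Fin k → G) (g : G) : Fin (k + 1) → G :=
  Fin.cons g fun i => h i * g

/-- The inner product `⟨v, w⟩` (antilinear in the first argument). -/
def inn {K : ℕ} (v w : Vec G K) : ℂ := star v ⬝ᵥ w

/-- The rank-one operator `|v⟩⟨w|`. -/
def outer {K : ℕ} (v w : Vec G K) : Op G K :=
  Matrix.of fun x y => v x * (starRingEnd ℂ) (w y)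

/-- The matrix element `⟨v|A|w⟩`. -/
def melem {K : ℕ} (v : Vec G K) (A : Op G K) (w : Vec G K) : ℂ :=
  star v ⬝ᵥ A.mulVec w

/-- The Hilbert–Schmidt inner product `⟨A,B⟩ := tr(A† B)`. -/
def hsInner {K : ℕ} (A B : Op G K) : ℂ := (Aᴴ * B).trace

variable (G)

/-- The symmetry group `U_sym` of relation-conditional global translations
(for `k+1` particles). -/
def Usym (k : ℕ) : Set (Op G (k + 1)) :=
  {U | U ∈ Matrix.unitaryGroup (Fin (k + 1) → G) ℂ ∧
    ∃ c : (Fin k → G) → G, ∀ (h : Fin k → G) (g : G),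
      U.mulVec (ket (cfg h g)) = (trans (c h)).mulVec (ket (cfg h g))}

/-- The characters of `G`: monoid homomorphisms `G → ℂ` of modulus one. -/
def Ghat : Type := {χ : G →* ℂ // ∀ g : G, ‖χ g‖ = 1}

/-- The trivial character `𝟙`. -/
instance : One (Ghat G) := ⟨⟨1, fun g => by simp⟩⟩

variable {G}

/-- The vector `|h;χ⟩ := |G|^{-1/2} ∑_{g ∈ G} χ(g⁻¹) |g, hg⟩`. -/
def relKet {k : ℕ} (h : Fin k → G) (χ : Ghat G) : Vec G (k + 1) :=
  ((Real.sqrt (Fintype.card G) : ℂ))⁻¹ • ∑ g : G, χ.1 g⁻¹ • ket (cfg h g)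

variable (G)

/-- The relational subspace `H_phys = span{|h;𝟙⟩}`. -/
def Hphys (k : ℕ) : Submodule ℂ (Vec G (k + 1)) :=
  Submodule.span ℂ {v | ∃ h : Fin k → G, v = relKet h (1 : Ghat G)}

/-- `Π_phys = ∑_h |h;𝟙⟩⟨h;𝟙|`, the orthogonal projection onto `H_phys`. -/
def Piphys (k : ℕ) : Op G (k + 1) :=
  ∑ h : Fin k → G, outer (relKet h (1 : Ghat G)) (relKet h (1 : Ghat G))

variable {G}

/-- `Π_{h;χ≠𝟙} = ∑_{χ ∈ Ĝ, χ ≠ 𝟙} |h;χ⟩⟨h;χ|`. -/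
def PiNot1 {k : ℕ} (h : Fin k → G) : Op G (k + 1) :=
  ∑ᶠ (χ : Ghat G) (_ : χ ≠ 1), outer (relKet h χ) (relKet h χ)

variable (G)

/-- The invariant algebra `A_inv`. -/
def Ainv (k : ℕ) : Set (Op G (k + 1)) :=
  {A | ∀ U ∈ Usym G k, U * A * Uᴴ = A}

/-- The incoherent group average (twirl) `Π_inv` over `U_sym`. -/
def Piinv (k : ℕ) (ρ : Op G (k + 1)) : Op G (k + 1) :=
  (Nat.card ↥(Usym G k) : ℂ)⁻¹ • ∑ᶠ U ∈ Usym G k, U * ρ * Uᴴ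

/-- The algebra `A_phys` of relational observables (operators supported on `H_phys`). -/
def Aphys (k : ℕ) : Set (Op G (k + 1)) :=
  {A | A = Piphys G k * A * Piphys G k}

/-- The algebra `A_alg`. -/
def Aalg (k : ℕ) : Set (Op G (k + 1)) :=
  {X | ∃ B ∈ Aphys G k, ∃ a : (Fin k → G) → ℂ,
      X = B + ∑ h : Fin k → G, a h • PiNot1 h}

variable {G}

/-- The vector `|e⟩_i ⊗ φ`. -/
def insVec {k : ℕ} (i : Fin (k + 1)) (φ : (Fin k → G) → ℂ) : Vec G (k + 1) :=
  fun x => if x i = 1 then φ (fun j => x (i.succAbove j)) else 0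

/-- The operator `|e⟩⟨e|_i ⊗ A`. -/
def eAop {k : ℕ} (i : Fin (k + 1)) (A : Matrix (Fin k → G) (Fin k → G) ℂ) :
    Op G (k + 1) :=
  Matrix.of fun x y =>
    if x i = 1 ∧ y i = 1 then
      A (fun j => x (i.succAbove j)) (fun j => y (i.succAbove j))
    else 0

/-- `ψ` is `i`-alignable. -/
def IAlignable {k : ℕ} (i : Fin (k + 1)) (ψ : Vec G (k + 1)) : Prop :=
  ∃ (θ : ℝ) (U : Op G (k + 1)) (φ : (Fin k → G) → ℂ),
    U ∈ Usym G k ∧ ψ = Complex.exp (θ * Complex.I) • U.mulVec (insVec i φ)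

/-- `ψ` is alignable. -/
def Alignable {k : ℕ} (ψ : Vec G (k + 1)) : Prop := ∃ i, IAlignable i ψ

/-- Symmetry equivalence of state vectors (up to a global phase). -/
def SymmEquiv {k : ℕ} (ψ ψ' : Vec G (k + 1)) : Prop :=
  ∃ (θ : ℝ) (U : Op G (k + 1)),
    U ∈ Usym G k ∧ ψ' = Complex.exp (θ * Complex.I) • U.mulVec ψ

/-- `P` is the orthogonal projection of operator space onto the set `S`,
with respect to the Hilbert–Schmidt inner product. -/
def IsHSProj {K : ℕ} (S : Set (Op G K)) (P : Op G K →ₗ[ℂ] Op G K) : Prop :=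
  (∀ ρ, P ρ ∈ S) ∧ (∀ A ∈ S, P A = A) ∧
    ∀ ρ σ, hsInner (P ρ) σ = hsInner ρ (P σ)

/-- First `n+1` components of an `(n+1)+(m+1)`-particle configuration. -/
def split1 {n m : ℕ} (x : Fin (n + m + 1 + 1) → G) : Fin (n + 1) → G :=
  fun i => x ⟨i.1, by have := i.2; omega⟩

/-- Last `m+1` components of an `(n+1)+(m+1)`-particle configuration. -/
def split2 {n m : ℕ} (x : Fin (n + m + 1 + 1) → G) : Fin (m + 1) → G :=
  fun i => x ⟨n + 1 + i.1, by have := i.2; omega⟩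

/-- The tensor product `A ⊗ B` of operators, under the identification
`H_{N+M} ≅ H_N ⊗ H_M`, `|x,y⟩ ↦ |x⟩ ⊗ |y⟩`. -/
def tensorOp {n m : ℕ} (A : Op G (n + 1)) (B : Op G (m + 1)) :
    Op G (n + m + 1 + 1) :=
  Matrix.of fun x y => A (split1 x) (split1 y) * B (split2 x) (split2 y)

/-- Concatenation `(h, g⃗)` of relation tuples. -/
def relcat {n m : ℕ} (h : Fin n → G) (gv : Fin (m + 1) → G) :
    Fin (n + m + 1) → G :=
  (Fin.append h gv : Fin (n + (m + 1)) → G)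

/-- Joining of configurations `(x, z)`. -/
def join {n m : ℕ} (x : Fin (n + 1) → G) (z : Fin (m + 1) → G) :
    Fin (n + m + 1 + 1) → G :=
  fun i => if hi : i.1 < n + 1 then x ⟨i.1, hi⟩
           else z ⟨i.1 - (n + 1), by have := i.2; omega⟩

/-- The standard partial trace over the last `m+1` particles. -/
def ptraceM {n m : ℕ} (ρ : Op G (n + m + 1 + 1)) : Op G (n + 1) :=
  Matrix.of fun x y => ∑ z : Fin (m + 1) → G, ρ (join x z) (join y z)

end Defs

section Operators

variable {G : Type} {K : ℕ}

lemma mulVec_ket [Fintype G] [DecidableEq G] (A : Op G K) (x : Fin K → G) :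
    A.mulVec (ket x) = fun y => A y x := by
  funext y
  simp [mulVec, dotProduct, ket]

lemma outer_eq_vecMulVec (v w : Vec G K) : outer v w = vecMulVec v (star w) := rfl

lemma conjTranspose_outer (v w : Vec G K) : (outer v w)ᴴ = outer w v := by
  rw [outer_eq_vecMulVec, conjTranspose_vecMulVec, star_star]
  rfl

lemma mul_outer [Fintype G] (A : Op G K) (v w : Vec G K) :
    A * outer v w = outer (A.mulVec v) w := by
  rw [outer_eq_vecMulVec, mul_vecMulVec]
  rfl

lemma trace_mul_outer [Fintype G] (A : Op G K) (v : Vec G K) :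
    (A * outer v v).trace = melem v A v := by
  rw [mul_outer, outer_eq_vecMulVec, trace_vecMulVec, dotProduct_comm]
  rfl

lemma outer_mulVec [Fintype G] (u w v : Vec G K) : (outer u w).mulVec v = inn w v • u := by
  rw [outer_eq_vecMulVec, vecMulVec_mulVec]
  funext x
  simp [inn, mul_comm]

lemma melem_outer [Fintype G] (v u w : Vec G K) :
    melem v (outer u w) v = inn v u * inn w v := by
  rw [melem, outer_mulVec, dotProduct_smul, smul_eq_mul, mul_comm]
  rfl

lemma star_inn [Fintype G] (v w : Vec G K) : (starRingEnd ℂ) (inn v w) = inn w v := by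
  simp [inn, dotProduct, map_sum, mul_comm]

end Operators

section Coordinates

variable {G : Type} [CommGroup G] {k : ℕ}

/-- The relations `h` of the configuration `(g, h₁ g, …, h_k g)`. -/
def rel (x : Fin (k + 1) → G) : Fin k → G := fun i => x i.succ * (x 0)⁻¹

/-- Configurations are parametrised by their relations and their first component. -/
def cfgEquiv : (Fin k → G) × G ≃ (Fin (k + 1) → G) where
  toFun p := cfg p.1 p.2
  invFun x := (rel x, x 0)
  left_inv p := by
    ext <;> simp [rel, cfg]
  right_inv x := by
    funext i
    refine Fin.cases ?_ (fun i => ?_) i <;> simp [rel, cfg]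

lemma cfg_rel (x : Fin (k + 1) → G) : cfg (rel x) (x 0) = x := cfgEquiv.right_inv x

lemma cfg_inj {h j : Fin k → G} {g g' : G} : cfg h g = cfg j g' ↔ h = j ∧ g = g' := by
  have := (cfgEquiv (G := G) (k := k)).injective.eq_iff (a := (h, g)) (b := (j, g'))
  simpa [cfgEquiv] using this

lemma rel_cfg (h : Fin k → G) (g : G) : rel (cfg h g) = h := by
  funext i
  simp [rel, cfg]

lemma smul_cfg (h : Fin k → G) (a g : G) : (fun i => a * cfg h g i) = cfg h (a * g) := by
  funext i
  refine Fin.cases ?_ (fun i => ?_) i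
  · simp [cfg]
  · simp [cfg, mul_left_comm]

lemma cfg_apply (h : Fin k → G) (g : G) (i : Fin (k + 1)) : cfg h g i = cfg h 1 i * g := by
  have := congrFun (smul_cfg h g 1) i
  rw [mul_one] at this
  rw [← this, mul_comm]

lemma sum_cfg [Fintype G] {M : Type} [AddCommMonoid M] (f : (Fin (k + 1) → G) → M) :
    ∑ x, f x = ∑ h : Fin k → G, ∑ g : G, f (cfg h g) := by
  rw [← Fintype.sum_prod_type', ← Equiv.sum_comp cfgEquiv]
  rfl

lemma vec_ext_cfg {v w : Vec G (k + 1)} (H : ∀ h g, v (cfg h g) = w (cfg h g)) : v = w := by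
  funext x
  rw [← cfg_rel x]
  exact H _ _

lemma op_ext_cfg {A B : Op G (k + 1)}
    (H : ∀ h g j g', A (cfg h g) (cfg j g') = B (cfg h g) (cfg j g')) : A = B := by
  ext x y
  rw [← cfg_rel x, ← cfg_rel y]
  exact H _ _ _ _

lemma ket_cfg [DecidableEq G] (h j : Fin k → G) (g g' : G) :
    ket (cfg h g) (cfg j g') = if j = h ∧ g' = g then 1 else 0 := by
  simp [ket, cfg_inj]

lemma trans_mulVec_ket_cfg [Fintype G] [DecidableEq G] (a : G) (h : Fin k → G) (g : G) :
    (trans a).mulVec (ket (cfg h g)) = ket (cfg h (a * g)) := by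
  rw [mulVec_ket]
  funext y
  simp [trans, ket, smul_cfg]

end Coordinates

section ConditionalTranslations

variable {G : Type} [DecidableEq G] [CommGroup G] {k : ℕ}

/-- The translation of every configuration by a group element depending on its relations. -/
def condOp (d : (Fin k → G) → G) : Op G (k + 1) :=
  Matrix.of fun x y => if x = cfg (rel y) (d (rel y) * y 0) then 1 else 0

lemma condOp_cfg (d : (Fin k → G) → G) (h j : Fin k → G) (g g' : G) :
    condOp d (cfg h g) (cfg j g') = if h = j ∧ g = d j * g' then 1 else 0 := by
  have : cfg j g' 0 = g' := by simp [cfg]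
  simp [condOp, rel_cfg, cfg_inj, this]

lemma condOp_injective : Function.Injective (condOp (G := G) (k := k)) := by
  intro d d' H
  funext h
  have := congrFun (congrFun H (cfg h (d h))) (cfg h 1)
  simpa [condOp_cfg] using this

variable [Fintype G]

lemma condOp_mulVec_cfg (d : (Fin k → G) → G) (v : Vec G (k + 1)) (h : Fin k → G) (g : G) :
    (condOp d).mulVec v (cfg h g) = v (cfg h ((d h)⁻¹ * g)) := by
  have e (j : Fin k → G) (g' : G) : (h = j ∧ g = d j * g') ↔ (j = h ∧ g' = (d h)⁻¹ * g) := by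
    constructor <;> rintro ⟨rfl, rfl⟩ <;> simp
  simp [mulVec, dotProduct, sum_cfg, condOp_cfg, e, ite_and]

lemma condOp_mul_cfg (d : (Fin k → G) → G) (A : Op G (k + 1)) (h : Fin k → G) (g : G)
    (y : Fin (k + 1) → G) :
    (condOp d * A) (cfg h g) y = A (cfg h ((d h)⁻¹ * g)) y :=
  condOp_mulVec_cfg d (fun x => A x y) h g

lemma mul_conjTranspose_condOp_cfg (d : (Fin k → G) → G) (A : Op G (k + 1))
    (x : Fin (k + 1) → G) (h : Fin k → G) (g : G) :
    (A * (condOp d)ᴴ) x (cfg h g) = A x (cfg h ((d h)⁻¹ * g)) := by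
  have e : A * (condOp d)ᴴ = (condOp d * Aᴴ)ᴴ := by simp
  rw [e, conjTranspose_apply, condOp_mul_cfg, conjTranspose_apply, star_star]

lemma conj_condOp_cfg (d : (Fin k → G) → G) (A : Op G (k + 1)) (h j : Fin k → G) (g g' : G) :
    (condOp d * A * (condOp d)ᴴ) (cfg h g) (cfg j g') =
      A (cfg h ((d h)⁻¹ * g)) (cfg j ((d j)⁻¹ * g')) := by
  rw [mul_conjTranspose_condOp_cfg, condOp_mul_cfg]

lemma condOp_mem_unitaryGroup (d : (Fin k → G) → G) :
    condOp d ∈ Matrix.unitaryGroup (Fin (k + 1) → G) ℂ := by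
  rw [mem_unitaryGroup_iff, star_eq_conjTranspose]
  refine op_ext_cfg fun h g j g' => ?_
  rw [mul_conjTranspose_condOp_cfg, condOp_cfg]
  simp [one_apply, cfg_inj]

lemma Usym_eq_range : Usym G k = Set.range (condOp (G := G) (k := k)) := by
  ext U
  constructor
  · rintro ⟨-, d, hd⟩
    refine ⟨d, op_ext_cfg fun h g j g' => ?_⟩
    have := congrFun (hd j g') (cfg h g)
    rw [trans_mulVec_ket_cfg, mulVec_ket, ket_cfg] at this
    rw [condOp_cfg]
    exact this.symm
  · rintro ⟨d, rfl⟩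
    refine ⟨condOp_mem_unitaryGroup d, d, fun h g => vec_ext_cfg fun j g' => ?_⟩
    rw [trans_mulVec_ket_cfg, mulVec_ket, ket_cfg]
    exact condOp_cfg d j h g' g

lemma Piinv_cfg (ρ : Op G (k + 1)) (h j : Fin k → G) (g g' : G) :
    Piinv G k ρ (cfg h g) (cfg j g') =
      (Fintype.card ((Fin k → G) → G) : ℂ)⁻¹ *
        ∑ d : (Fin k → G) → G, ρ (cfg h ((d h)⁻¹ * g)) (cfg j ((d j)⁻¹ * g')) := by
  rw [Piinv, Usym_eq_range, finsum_mem_range condOp_injective, finsum_eq_sum_of_fintype,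
    Nat.card_range_of_injective condOp_injective, Nat.card_eq_fintype_card]
  simp [Matrix.sum_apply, conj_condOp_cfg]

/-- Averaging over functions makes the values at distinct points independent and uniform. -/
lemma average_indicator {F : Type} [Fintype F] [DecidableEq F] (h j : F) (a b : G) :
    (Fintype.card (F → G) : ℂ)⁻¹ *
        ∑ d : F → G, (if d h = a then (1 : ℂ) else 0) * (if d j = b then 1 else 0) =
      if h = j then (if a = b then (Fintype.card G : ℂ)⁻¹ else 0)
      else (Fintype.card G : ℂ)⁻¹ * (Fintype.card G : ℂ)⁻¹ := by
  have hG : (Fintype.card G : ℂ) ≠ 0 := Nat.cast_ne_zero.mpr Fintype.card_ne_zero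
  let f : F → G → ℂ := fun l g =>
    (if l = h then (if g = a then 1 else 0) else 1) *
      (if l = j then (if g = b then 1 else 0) else 1)
  have hf (d : F → G) : (if d h = a then (1 : ℂ) else 0) * (if d j = b then 1 else 0) =
      ∏ l, f l (d l) := by
    simp only [f, Finset.prod_mul_distrib, Finset.prod_ite_eq', Finset.mem_univ, if_true]
  have hcard : (Fintype.card (F → G) : ℂ)⁻¹ = ∏ _l : F, (Fintype.card G : ℂ)⁻¹ := by
    simp
  simp_rw [hf]
  rw [hcard, ← Fintype.prod_sum, ← Finset.prod_mul_distrib]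
  by_cases hj : h = j
  · subst hj
    have (l : F) : (Fintype.card G : ℂ)⁻¹ * ∑ g, f l g =
        if l = h then (if a = b then (Fintype.card G : ℂ)⁻¹ else 0) else 1 := by
      by_cases hl : l = h
      · simp [f, hl, eq_comm]
      · simp [f, hl, hG]
    simp_rw [this]
    simp
  · have (l : F) : (Fintype.card G : ℂ)⁻¹ * ∑ g, f l g =
        (if l = h then (Fintype.card G : ℂ)⁻¹ else 1) *
          (if l = j then (Fintype.card G : ℂ)⁻¹ else 1) := by
      by_cases hl : l = h
      · subst hl
        simp [f, hj]
      · by_cases hl' : l = j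
        · subst hl'
          simp [f, hl]
        · simp [f, hl, hl', hG]
    simp_rw [this, Finset.prod_mul_distrib]
    simp [hj]

end ConditionalTranslations

section Characters

lemma sqrt_card_inv_mul_self {G : Type} [Fintype G] : ((Real.sqrt (Fintype.card G) : ℂ))⁻¹ *
    ((Real.sqrt (Fintype.card G) : ℂ))⁻¹ = (Fintype.card G : ℂ)⁻¹ := by
  rw [← mul_inv, ← Complex.ofReal_mul, Real.mul_self_sqrt (Nat.cast_nonneg _),
    Complex.ofReal_natCast]

variable {G : Type} [CommGroup G] {k : ℕ}

lemma Ghat.conj_apply (χ : Ghat G) (g : G) : (starRingEnd ℂ) (χ.1 g) = χ.1 g⁻¹ := by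
  have h : χ.1 g * χ.1 g⁻¹ = 1 := by rw [← map_mul, mul_inv_cancel, map_one]
  rw [← RCLike.inv_eq_conj (χ.2 g)]
  exact inv_eq_of_mul_eq_one_right h

lemma Ghat.one_apply (g : G) : (1 : Ghat G).1 g = 1 := rfl

variable [Fintype G]

/-- Characters of `G` are the additive characters of its additive copy. -/
def ghatEquiv : Ghat G ≃ AddChar (Additive G) ℂ where
  toFun χ :=
    { toFun := fun a => χ.1 a.toMul
      map_zero_eq_one' := map_one χ.1
      map_add_eq_mul' := fun a b => map_mul χ.1 a.toMul b.toMul }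
  invFun ψ :=
    ⟨{ toFun := fun g => ψ (Additive.ofMul g)
       map_one' := ψ.map_zero_eq_one
       map_mul' := fun a b => ψ.map_add_eq_mul (Additive.ofMul a) (Additive.ofMul b) },
      fun g => ψ.norm_apply (Additive.ofMul g)⟩
  left_inv _ := rfl
  right_inv _ := rfl

instance : Fintype (Ghat G) := Fintype.ofEquiv _ ghatEquiv.symm

lemma sqrt_card_inv_ne_zero : ((Real.sqrt (Fintype.card G) : ℂ))⁻¹ ≠ 0 := by
  intro h
  have := sqrt_card_inv_mul_self (G := G)
  rw [h, mul_zero, eq_comm, inv_eq_zero] at this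
  exact Fintype.card_ne_zero (α := G) (by exact_mod_cast this)

variable [DecidableEq G]

lemma Ghat.sum_apply (g : G) :
    ∑ χ : Ghat G, χ.1 g = if g = 1 then (Fintype.card G : ℂ) else 0 := by
  have := AddChar.sum_apply_eq_ite (Additive.ofMul g)
  rw [← Equiv.sum_comp ghatEquiv] at this
  simp only [Fintype.card_additive, ofMul_eq_zero] at this
  exact this

lemma relKet_cfg (h j : Fin k → G) (χ : Ghat G) (g : G) :
    relKet h χ (cfg j g) =
      if j = h then ((Real.sqrt (Fintype.card G) : ℂ))⁻¹ * χ.1 g⁻¹ else 0 := by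
  by_cases hj : j = h <;> simp [relKet, Finset.sum_apply, ket_cfg, hj]

lemma outer_relKet_cfg (h h' : Fin k → G) (χ : Ghat G) (l j : Fin k → G) (g g' : G) :
    outer (relKet h χ) (relKet h' χ) (cfg l g) (cfg j g') =
      if l = h ∧ j = h' then (Fintype.card G : ℂ)⁻¹ * χ.1 (g⁻¹ * g') else 0 := by
  have e : outer (relKet h χ) (relKet h' χ) (cfg l g) (cfg j g') =
    relKet h χ (cfg l g) * (starRingEnd ℂ) (relKet h' χ (cfg j g')) := rfl
  rw [e, relKet_cfg, relKet_cfg]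
  by_cases hl : l = h
  · by_cases hj : j = h'
    · simp only [hl, hj, and_self, if_true, map_mul, map_inv₀, Complex.conj_ofReal,
        Ghat.conj_apply, inv_inv, ← sqrt_card_inv_mul_self]
      ring
    · simp [hj]
  · simp [hl]

lemma PiNot1_cfg (h l j : Fin k → G) (g g' : G) :
    PiNot1 h (cfg l g) (cfg j g') =
      if l = h ∧ j = h then (if g = g' then 1 else 0) - (Fintype.card G : ℂ)⁻¹ else 0 := by
  have hG : (Fintype.card G : ℂ) ≠ 0 := Nat.cast_ne_zero.mpr Fintype.card_ne_zero
  have e : PiNot1 h = (∑ χ : Ghat G, outer (relKet h χ) (relKet h χ)) -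
      outer (relKet h 1) (relKet h 1) := by
    rw [PiNot1, ← finsum_eq_sum_of_fintype, eq_sub_iff_add_eq']
    exact add_finsum_cond_ne (f := fun χ : Ghat G => outer (relKet h χ) (relKet h χ)) 1
      (Set.toFinite _)
  rw [e, Matrix.sub_apply, Matrix.sum_apply]
  simp_rw [outer_relKet_cfg]
  by_cases hl : l = h ∧ j = h
  · simp only [hl, and_self, if_true, ← Finset.mul_sum, Ghat.sum_apply, Ghat.one_apply, mul_one,
      inv_mul_eq_one]
    by_cases hg : g = g' <;> simp [hg, hG]
  · simp [hl]

end Characters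

section Alignable

variable {G : Type} [Fintype G] [DecidableEq G] [CommGroup G] {k : ℕ}

/-- The vector `∑_h α_h |c(h), h c(h)⟩`. -/
def alignedVec (c : (Fin k → G) → G) (α : (Fin k → G) → ℂ) : Vec G (k + 1) :=
  ∑ h : Fin k → G, α h • ket (cfg h (c h))

lemma alignedVec_cfg (c : (Fin k → G) → G) (α : (Fin k → G) → ℂ) (h : Fin k → G) (g : G) :
    alignedVec c α (cfg h g) = if g = c h then α h else 0 := by
  simp [alignedVec, Finset.sum_apply, ket_cfg, ite_and]

lemma Alignable.exists_eq_alignedVec {ψ : Vec G (k + 1)} (hψ : Alignable ψ) :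
    ∃ c α, ψ = alignedVec c α := by
  obtain ⟨i, θ, U, φ, hU, rfl⟩ := hψ
  rw [Usym_eq_range] at hU
  obtain ⟨d, rfl⟩ := hU
  refine ⟨fun h => d h * (cfg h 1 i)⁻¹, fun h => Complex.exp (θ * Complex.I) *
    φ (fun j => cfg h (cfg h 1 i)⁻¹ (i.succAbove j)), vec_ext_cfg fun h g => ?_⟩
  have e : cfg h ((d h)⁻¹ * g) i = 1 ↔ g = d h * (cfg h 1 i)⁻¹ := by
    rw [cfg_apply, mul_eq_one_iff_inv_eq, eq_inv_mul_iff_mul_eq, eq_comm]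
  rw [alignedVec_cfg, Pi.smul_apply, condOp_mulVec_cfg, insVec, smul_eq_mul]
  by_cases hg : g = d h * (cfg h 1 i)⁻¹
  · rw [if_pos (e.2 hg), if_pos hg, hg, inv_mul_cancel_left]
  · rw [if_neg (mt e.1 hg), if_neg hg, mul_zero]

lemma Piinv_alignedVec (c : (Fin k → G) → G) (α : (Fin k → G) → ℂ) :
    Piinv G k (outer (alignedVec c α) (alignedVec c α)) =
      (∑ h : Fin k → G, ∑ j : Fin k → G,
        (α h * (starRingEnd ℂ) (α j) / (Fintype.card G : ℂ)) •
          outer (relKet h (1 : Ghat G)) (relKet j (1 : Ghat G))) +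
      ∑ h : Fin k → G,
        (α h * (starRingEnd ℂ) (α h) / (Fintype.card G : ℂ)) • PiNot1 h := by
  refine op_ext_cfg fun h g j g' => ?_
  have hentry (d : (Fin k → G) → G) :
      outer (alignedVec c α) (alignedVec c α) (cfg h ((d h)⁻¹ * g)) (cfg j ((d j)⁻¹ * g')) =
        α h * (starRingEnd ℂ) (α j) * ((if d h = g * (c h)⁻¹ then (1 : ℂ) else 0) *
          (if d j = g' * (c j)⁻¹ then 1 else 0)) := by
    have e (a b x : G) : a⁻¹ * b = x ↔ a = b * x⁻¹ := by
      rw [inv_mul_eq_iff_eq_mul, eq_mul_inv_iff_mul_eq, eq_comm]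
    have e' : outer (alignedVec c α) (alignedVec c α) (cfg h ((d h)⁻¹ * g))
        (cfg j ((d j)⁻¹ * g')) = alignedVec c α (cfg h ((d h)⁻¹ * g)) *
          (starRingEnd ℂ) (alignedVec c α (cfg j ((d j)⁻¹ * g'))) := rfl
    rw [e', alignedVec_cfg, alignedVec_cfg]
    simp only [e]
    split_ifs <;> simp
  rw [Piinv_cfg]
  simp_rw [hentry]
  rw [← Finset.mul_sum, mul_left_comm, average_indicator]
  simp only [Matrix.add_apply, Matrix.sum_apply, Matrix.smul_apply, outer_relKet_cfg, PiNot1_cfg,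
    smul_eq_mul, Ghat.one_apply, mul_one, mul_ite, mul_zero, ite_and, Finset.sum_ite_eq,
    Finset.mem_univ, if_true, Finset.sum_ite_irrel, Finset.sum_const_zero]
  by_cases hj : h = j
  · subst hj
    by_cases hg : g = g'
    · simp [hg]
      ring
    · simp [hg]
  · simp [hj, Ne.symm hj]
    ring

end Alignable

section Physical

variable {G : Type} [Fintype G] [DecidableEq G] [CommGroup G] {k : ℕ}

lemma inn_relKet_one (h : Fin k → G) (v : Vec G (k + 1)) :
    inn (relKet h (1 : Ghat G)) v =
      ((Real.sqrt (Fintype.card G) : ℂ))⁻¹ * ∑ g, v (cfg h g) := by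
  simp only [inn, dotProduct, sum_cfg, Pi.star_apply, relKet_cfg, Ghat.one_apply, mul_one,
    apply_ite star, star_zero, ite_mul, zero_mul, Finset.sum_ite_irrel, Finset.sum_const_zero,
    Finset.sum_ite_eq', Finset.mem_univ, if_true, Finset.mul_sum]
  simp

lemma inn_relKet_relKet (h j : Fin k → G) :
    inn (relKet h (1 : Ghat G)) (relKet j (1 : Ghat G)) = if j = h then 1 else 0 := by
  have hG : (Fintype.card G : ℂ) ≠ 0 := Nat.cast_ne_zero.mpr Fintype.card_ne_zero
  rw [inn_relKet_one]
  simp only [relKet_cfg, Ghat.one_apply, mul_one, eq_comm (a := h)]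
  split_ifs
  · rw [Finset.sum_const, Finset.card_univ, nsmul_eq_mul, mul_left_comm, sqrt_card_inv_mul_self,
      mul_inv_cancel₀ hG]
  · simp

lemma Piphys_mulVec_relKet (h : Fin k → G) :
    (Piphys G k).mulVec (relKet h 1) = relKet h 1 := by
  simp [Piphys, Matrix.sum_mulVec, outer_mulVec, inn_relKet_relKet]

lemma conjTranspose_Piphys : (Piphys G k)ᴴ = Piphys G k := by
  simp [Piphys, conjTranspose_sum, conjTranspose_outer]

lemma outer_relKet_mem_Aphys (h j : Fin k → G) :
    outer (relKet h (1 : Ghat G)) (relKet j 1) ∈ Aphys G k := by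
  have e (a b : Fin k → G) : Piphys G k * outer (relKet a (1 : Ghat G)) (relKet b 1) =
      outer (relKet a (1 : Ghat G)) (relKet b 1) := by
    rw [mul_outer, Piphys_mulVec_relKet]
  have e' := congrArg conjTranspose (e j h)
  rw [conjTranspose_mul, conjTranspose_outer, conjTranspose_Piphys] at e'
  change _ = _
  rw [e, e']

lemma condOp_mul_Piphys (d : (Fin k → G) → G) : condOp d * Piphys G k = Piphys G k := by
  have e (h : Fin k → G) : (condOp d).mulVec (relKet h 1) = relKet h 1 := by
    refine vec_ext_cfg fun j g => ?_
    simp [condOp_mulVec_cfg, relKet_cfg, Ghat.one_apply]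
  simp [Piphys, Finset.mul_sum, mul_outer, e]

lemma Aphys_subset_Ainv : Aphys G k ⊆ Ainv G k := by
  intro A hA U hU
  rw [Usym_eq_range] at hU
  obtain ⟨d, rfl⟩ := hU
  have e := congrArg conjTranspose (condOp_mul_Piphys (G := G) d)
  rw [conjTranspose_mul, conjTranspose_Piphys] at e
  have hA' : A = Piphys G k * A * Piphys G k := hA
  calc condOp d * A * (condOp d)ᴴ
      = (condOp d * Piphys G k) * A * (Piphys G k * (condOp d)ᴴ) := by
        conv_lhs => rw [hA']
        simp only [Matrix.mul_assoc]
    _ = A := by rw [condOp_mul_Piphys, e, ← hA']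

lemma SymmEquiv.melem_eq {ψ ψ' : Vec G (k + 1)} (H : SymmEquiv ψ ψ') {A : Op G (k + 1)}
    (hA : A ∈ Ainv G k) : melem ψ A ψ = melem ψ' A ψ' := by
  obtain ⟨θ, U, hU, rfl⟩ := H
  have hUU : Uᴴ * U = 1 := mem_unitaryGroup_iff'.1 hU.1
  have hinv : Uᴴ * A * U = A := by
    conv_lhs => rw [← hA U hU]
    calc Uᴴ * (U * A * Uᴴ) * U = (Uᴴ * U) * A * (Uᴴ * U) := by simp only [Matrix.mul_assoc]
      _ = A := by rw [hUU, Matrix.one_mul, Matrix.mul_one]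
  have hz : star (Complex.exp (θ * Complex.I)) * Complex.exp (θ * Complex.I) = 1 := by
    have := Complex.conj_mul' (Complex.exp (θ * Complex.I))
    rw [Complex.norm_exp_ofReal_mul_I] at this
    simpa using this
  simp only [melem]
  rw [star_smul, mulVec_smul, smul_dotProduct, dotProduct_smul, smul_smul, hz, one_smul,
    star_mulVec, ← dotProduct_mulVec, mulVec_mulVec, mulVec_mulVec, hinv]

/-- Vectors with the same rank-one operator agree up to a global phase. -/
lemma exists_phase_of_mul_conj_eq {ι : Type} {α β : ι → ℂ}
    (H : ∀ i j, α i * (starRingEnd ℂ) (α j) = β i * (starRingEnd ℂ) (β j)) :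
    ∃ θ : ℝ, ∀ i, β i = Complex.exp (θ * Complex.I) * α i := by
  have hn (i : ι) : ‖α i‖ = ‖β i‖ := by
    have := congrArg norm (H i i)
    simp only [norm_mul, RCLike.norm_conj] at this
    exact (mul_self_inj (norm_nonneg _) (norm_nonneg _)).1 this
  by_cases h0 : ∃ i, α i ≠ 0
  · obtain ⟨j, hj⟩ := h0
    have hβ : β j ≠ 0 := by
      rw [← norm_ne_zero_iff, ← hn, norm_ne_zero_iff]
      exact hj
    have hz : ‖β j / α j‖ = 1 := by
      rw [norm_div, hn, div_self (norm_ne_zero_iff.2 hβ)]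
    refine ⟨(β j / α j).arg, fun i => ?_⟩
    have hexp : Complex.exp ((β j / α j).arg * Complex.I) = β j / α j := by
      have := Complex.norm_mul_exp_arg_mul_I (β j / α j)
      rwa [hz, Complex.ofReal_one, one_mul] at this
    have hc : (starRingEnd ℂ) (β j) ≠ 0 := (map_ne_zero _).2 hβ
    rw [hexp, div_mul_eq_mul_div, eq_div_iff hj]
    apply mul_right_cancel₀ hc
    have h1 := H i j
    have h2 := H j j
    linear_combination (-α j) * h1 + α i * h2
  · push Not at h0
    refine ⟨0, fun i => ?_⟩
    have := hn i
    rw [h0 i, norm_zero, eq_comm, norm_eq_zero] at this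
    rw [h0 i, this, mul_zero]

lemma symmEquiv_alignedVec {c c' : (Fin k → G) → G} {α α' : (Fin k → G) → ℂ}
    (H : ∀ A ∈ Aphys G k, melem (alignedVec c α) A (alignedVec c α) =
      melem (alignedVec c' α') A (alignedVec c' α')) :
    SymmEquiv (alignedVec c α) (alignedVec c' α') := by
  have hinn (c : (Fin k → G) → G) (α : (Fin k → G) → ℂ) (h : Fin k → G) :
      inn (relKet h (1 : Ghat G)) (alignedVec c α) =
        ((Real.sqrt (Fintype.card G) : ℂ))⁻¹ * α h := by
    simp [inn_relKet_one, alignedVec_cfg]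
  obtain ⟨θ, hθ⟩ := exists_phase_of_mul_conj_eq (α := α) (β := α') fun (h j : Fin k → G) => by
    have := H (outer (relKet j (1 : Ghat G)) (relKet h 1)) (outer_relKet_mem_Aphys j h)
    simp only [melem_outer, ← star_inn (relKet j (1 : Ghat G)), hinn, map_mul, map_inv₀,
      Complex.conj_ofReal] at this
    have hs := sqrt_card_inv_ne_zero (G := G)
    apply mul_left_cancel₀ (mul_ne_zero hs hs)
    linear_combination this
  refine ⟨θ, condOp fun h => c' h * (c h)⁻¹, ?_,
    vec_ext_cfg fun h g => ?_⟩
  · rw [Usym_eq_range]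
    exact Set.mem_range_self _
  have e : (c' h * (c h)⁻¹)⁻¹ * g = c h ↔ g = c' h := by
    rw [inv_mul_eq_iff_eq_mul, inv_mul_cancel_right]
  simp only [Pi.smul_apply, condOp_mulVec_cfg, alignedVec_cfg, hθ h, e, smul_eq_mul, mul_ite,
    mul_zero]

end Physical

/-- Explicit form of the twirl `Π_inv(|ψ⟩⟨ψ|)` of an alignable
state, and the equivalence, for alignable unit vectors, of (i) observational
equivalence, (ii) symmetry equivalence, (iii) equality of all expectation values of
relational observables in `A_phys`. -/
theorem stmt10 (G : Type) [Fintype G] [DecidableEq G] [CommGroup G] (n : ℕ) :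
    (∀ (c : (Fin n → G) → G) (α : (Fin n → G) → ℂ),
      Piinv G n (outer (∑ h : Fin n → G, α h • ket (cfg h (c h)))
                       (∑ h : Fin n → G, α h • ket (cfg h (c h)))) =
        (∑ h : Fin n → G, ∑ j : Fin n → G,
          (α h * (starRingEnd ℂ) (α j) / (Fintype.card G : ℂ)) •
            outer (relKet h (1 : Ghat G)) (relKet j (1 : Ghat G))) +
        ∑ h : Fin n → G,
          (α h * (starRingEnd ℂ) (α h) / (Fintype.card G : ℂ)) • PiNot1 h) ∧
    (∀ ψ ψ' : Vec G (n + 1), Alignable ψ → Alignable ψ' →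
      inn ψ ψ = 1 → inn ψ' ψ' = 1 →
      (((∀ A ∈ Ainv G n, (A * outer ψ ψ).trace = (A * outer ψ' ψ').trace) ↔
          SymmEquiv ψ ψ') ∧
        (SymmEquiv ψ ψ' ↔
          ∀ A ∈ Aphys G n, melem ψ A ψ = melem ψ' A ψ'))) := by
  refine ⟨Piinv_alignedVec, fun ψ ψ' hψ hψ' _ _ => ?_⟩
  obtain ⟨c, α, rfl⟩ := hψ.exists_eq_alignedVec
  obtain ⟨c', α', rfl⟩ := hψ'.exists_eq_alignedVec
  simp only [trace_mul_outer]
  exact ⟨⟨fun H => symmEquiv_alignedVec fun A hA => H A (Aphys_subset_Ainv hA),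
      fun H _ hA => H.melem_eq hA⟩,
    fun H _ hA => H.melem_eq (Aphys_subset_Ainv hA), symmEquiv_alignedVec⟩

end QRF

end
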